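/- If the finite-dimensional real Lie algebra g = (V,μ) contracts onto g' = (V,μ'), then for every k ≥ 0 one has dim H^k(g,ℝ) ≤ dim H^k(g',ℝ), where cohomology is taken with trivial coefficients. -/

import Mathlib

open Filter Topology Set

/-- A Lie bracket on a real vector space `V`: a bilinear alternating map satisfying
the Jacobi identity. -/
structure LieBracketOn (V : Type) [AddCommGroup V] [Module ℝ V] : Type where
  br : V →ₗ[ℝ] V →ₗ[ℝ] V
  alt : ∀ x : V, br x x = 0
  jacobi : ∀ x y z : V, br x (br y z) + br y (br z x) + br z (br x y) = 0

variable {V : Type} [NormedAddCommGroup V] [NormedSpace ℝ V]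

/-- `g = (V,μ)` contracts onto `g' = (V,μ')`: there is a family `Φ_t` of linear
automorphisms of `V` such that `Φ_t⁻¹ (μ (Φ_t X) (Φ_t Y)) → μ' X Y` as `t → ∞`. -/
def Contracts (μ μ' : LieBracketOn V) : Prop :=
  ∃ Φ : ℝ → (V ≃ₗ[ℝ] V), ∀ X Y : V,
    Tendsto (fun t : ℝ => (Φ t).symm (μ.br (Φ t X) (Φ t Y))) atTop (𝓝 (μ'.br X Y))

/-- `(V,μ)` and `(V,μ')` are isomorphic as Lie algebras. -/
def BrIso (μ μ' : LieBracketOn V) : Prop :=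
  ∃ e : V ≃ₗ[ℝ] V, ∀ x y : V, e (μ.br x y) = μ'.br (e x) (e y)

/-- `μt` is a deformation of plateau type from `g' = (V,μ')` to `g = (V,μ)`:
`t ↦ μ_t(X,Y)` is continuous on `[0,1]`, `μ_0 = μ'`, `(V,μ_t) ≃ (V,μ)` for all
`t ∈ (0,1]`, and `(V,μ') ≄ (V,μ)`. -/
def IsPlateauDeformation (μ' μ : LieBracketOn V) (μt : ℝ → LieBracketOn V) : Prop :=
  (∀ X Y : V, ContinuousOn (fun t => (μt t).br X Y) (Icc (0:ℝ) 1)) ∧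
  μt 0 = μ' ∧ (∀ t ∈ Ioc (0:ℝ) 1, BrIso (μt t) μ) ∧ ¬ BrIso μ' μ

open Filter Topology Set

namespace CE

variable {V W : Type} [AddCommGroup V] [Module ℝ V] [AddCommGroup W] [Module ℝ W]

/-- The Chevalley–Eilenberg coboundary of a `p`-cochain `Φ` (an alternating `p`-linear
map `V^p → W`), relative to a bracket `br` on `V` and an action `ρ` of `V` on `W`,
evaluated on a `(p+1)`-tuple `X` (indices `0,…,p` correspond to `X_1,…,X_{p+1}`):
`dΦ(X_0,…,X_p) = Σ_s (−1)^s ρ(X_s)(Φ(…,X̂_s,…))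
  + Σ_{s<t} (−1)^{s+t} Φ(br(X_s,X_t),…,X̂_s,…,X̂_t,…)`. -/
def ceDfun (br : V →ₗ[ℝ] V →ₗ[ℝ] V) (ρ : V →ₗ[ℝ] W →ₗ[ℝ] W) {p : ℕ}
    (Φ : V [⋀^Fin p]→ₗ[ℝ] W) (X : Fin (p + 1) → V) : W :=
  (∑ s : Fin (p + 1), ((-1 : ℝ) ^ (s : ℕ)) • ρ (X s) (Φ (X ∘ s.succAbove)))
  + ∑ s : Fin (p + 1), ∑ t : Fin (p + 1),
      if (s : ℕ) < (t : ℕ) then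
        ((-1 : ℝ) ^ ((s : ℕ) + (t : ℕ))) • Φ (fun i : Fin p =>
          if (i : ℕ) = 0 then br (X s) (X t)
          else if (i : ℕ) - 1 < (s : ℕ) then X ⟨(i : ℕ) - 1, by have := i.isLt; omega⟩
          else if (i : ℕ) < (t : ℕ) then X ⟨(i : ℕ), by have := i.isLt; omega⟩
          else X ⟨(i : ℕ) + 1, by have := i.isLt; omega⟩)
      else 0

/-- The Chevalley–Eilenberg coboundary, as a linear map into functions. -/
def ceD (br : V →ₗ[ℝ] V →ₗ[ℝ] V) (ρ : V →ₗ[ℝ] W →ₗ[ℝ] W) (p : ℕ) :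
    (V [⋀^Fin p]→ₗ[ℝ] W) →ₗ[ℝ] ((Fin (p + 1) → V) → W) where
  toFun Φ := ceDfun br ρ Φ
  map_add' Φ Ψ := by
    have key : ∀ {c : Prop} [Decidable c] (a b : W),
        (if c then a + b else 0) = (if c then a else 0) + (if c then b else 0) := by
      intro c _ a b; split <;> simp
    funext X
    simp only [ceDfun, AlternatingMap.add_apply, map_add, smul_add, Pi.add_apply,
      key, Finset.sum_add_distrib]
    abel
  map_smul' c Φ := by
    funext X
    simp only [ceDfun, AlternatingMap.smul_apply, map_smul, RingHom.id_apply, Pi.smul_apply,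
      smul_add, Finset.smul_sum, smul_ite, smul_zero, smul_smul, mul_comm]

/-- Evaluation of an alternating map as a plain function, as a linear map. -/
def altEval (q : ℕ) : (V [⋀^Fin q]→ₗ[ℝ] W) →ₗ[ℝ] ((Fin q → V) → W) where
  toFun Ψ := ⇑Ψ
  map_add' a b := by funext X; simp
  map_smul' c a := by funext X; simp

/-- The space `Z^p` of `p`-cocycles. -/
def ceZ (br : V →ₗ[ℝ] V →ₗ[ℝ] V) (ρ : V →ₗ[ℝ] W →ₗ[ℝ] W) (p : ℕ) :
    Submodule ℝ (V [⋀^Fin p]→ₗ[ℝ] W) :=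
  LinearMap.ker (ceD br ρ p)

/-- The space `B^p` of `p`-coboundaries (`B^0 = 0`). -/
def ceB (br : V →ₗ[ℝ] V →ₗ[ℝ] V) (ρ : V →ₗ[ℝ] W →ₗ[ℝ] W) :
    (p : ℕ) → Submodule ℝ (V [⋀^Fin p]→ₗ[ℝ] W)
  | 0 => ⊥
  | (p + 1) => Submodule.comap (altEval (p + 1)) (LinearMap.range (ceD br ρ p))

/-- The `p`-th Chevalley–Eilenberg cohomology space `H^p = Z^p / B^p`. -/
def CEH (br : V →ₗ[ℝ] V →ₗ[ℝ] V) (ρ : V →ₗ[ℝ] W →ₗ[ℝ] W) (p : ℕ) : Type :=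
  ceZ br ρ p ⧸ Submodule.comap (ceZ br ρ p).subtype (ceB br ρ p)

noncomputable instance (br : V →ₗ[ℝ] V →ₗ[ℝ] V) (ρ : V →ₗ[ℝ] W →ₗ[ℝ] W) (p : ℕ) :
    AddCommGroup (CEH br ρ p) :=
  inferInstanceAs (AddCommGroup (ceZ br ρ p ⧸ Submodule.comap (ceZ br ρ p).subtype (ceB br ρ p)))

noncomputable instance (br : V →ₗ[ℝ] V →ₗ[ℝ] V) (ρ : V →ₗ[ℝ] W →ₗ[ℝ] W) (p : ℕ) :
    Module ℝ (CEH br ρ p) :=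
  inferInstanceAs (Module ℝ (ceZ br ρ p ⧸ Submodule.comap (ceZ br ρ p).subtype (ceB br ρ p)))

/-- `dim H^p`. -/
noncomputable def Hdim (br : V →ₗ[ℝ] V →ₗ[ℝ] V) (ρ : V →ₗ[ℝ] W →ₗ[ℝ] W) (p : ℕ) : ℕ :=
  Module.finrank ℝ (CEH br ρ p)

end CE

namespace CE

open AlternatingMap (alternatizeUncurryFin alternatizeUncurryFinLM curryLeftLinearMap
  alternatizeUncurryFinLM_apply curryLeft_add curryLeft_smul)

section Cochains

variable {E : Type*} [AddCommGroup E] [Module ℝ E]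

theorem curryLeft_ext {n : ℕ} {f g : E [⋀^Fin (n + 1)]→ₗ[ℝ] ℝ}
    (h : ∀ x, f.curryLeft x = g.curryLeft x) : f = g := by
  ext v
  rw [← Matrix.cons_head_tail v]
  exact DFunLike.congr_fun (h (Matrix.vecHead v)) (Matrix.vecTail v)

theorem curryLeft_swap {n : ℕ} (f : E [⋀^Fin (n + 2)]→ₗ[ℝ] ℝ) (x y : E) :
    (f.curryLeft x).curryLeft y = -(f.curryLeft y).curryLeft x := by
  have h := f.curryLeft_same (x + y)
  have hx := f.curryLeft_same x
  have hy := f.curryLeft_same y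
  simp only [map_add, curryLeft_add, LinearMap.add_apply, hx, hy, zero_add, add_zero] at h
  exact eq_neg_of_add_eq_zero_right h

/-- Inserting `x` in the first slot of `alternatizeUncurryFin f` singles out the term `f x`. -/
theorem curryLeft_alternatizeUncurryFin {n : ℕ} (f : E →ₗ[ℝ] E [⋀^Fin (n + 1)]→ₗ[ℝ] ℝ) (x : E) :
    (alternatizeUncurryFin f).curryLeft x =
      f x - alternatizeUncurryFin ((curryLeftLinearMap.flip x) ∘ₗ f) := by
  ext v
  have h : ∀ i : Fin (n + 1), i.succ.removeNth (Matrix.vecCons x v) =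
      Matrix.vecCons x (i.removeNth v) := by
    intro i
    funext j
    refine Fin.cases ?_ (fun j => ?_) j <;> simp [Fin.removeNth]
  have h0 : (0 : Fin (n + 2)).removeNth (Matrix.vecCons x v) = v := by
    funext j
    simp [Fin.removeNth]
  rw [AlternatingMap.curryLeft_apply_apply, AlternatingMap.sub_apply,
    AlternatingMap.alternatizeUncurryFin_apply, AlternatingMap.alternatizeUncurryFin_apply,
    Fin.sum_univ_succ]
  simp [h, h0, pow_succ, sub_eq_add_neg]

theorem curryLeft_alternatizeUncurryFin_zero (f : E →ₗ[ℝ] E [⋀^Fin 0]→ₗ[ℝ] ℝ) (x : E) :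
    (alternatizeUncurryFin f).curryLeft x = f x := by
  ext v
  rw [AlternatingMap.curryLeft_apply_apply, AlternatingMap.alternatizeUncurryFin_apply,
    Fin.sum_univ_one, Subsingleton.elim (Fin.removeNth 0 (Matrix.vecCons x v)) v]
  simp

theorem alternatizeUncurryFin_neg {n : ℕ} (f : E →ₗ[ℝ] E [⋀^Fin n]→ₗ[ℝ] ℝ) :
    alternatizeUncurryFin (-f) = -alternatizeUncurryFin f := by
  ext v
  simp [AlternatingMap.alternatizeUncurryFin_apply]

/-- The action of an endomorphism `A` of `E` on alternating forms by
`Φ ↦ -∑ᵢ Φ (…, A xᵢ, …)`. -/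
noncomputable def lieAct :
    (n : ℕ) → (E →ₗ[ℝ] E) →ₗ[ℝ] (E [⋀^Fin n]→ₗ[ℝ] ℝ) →ₗ[ℝ] (E [⋀^Fin n]→ₗ[ℝ] ℝ)
  | 0 => 0
  | n + 1 => LinearMap.mk₂ ℝ (fun A Φ => -alternatizeUncurryFinLM (Φ.curryLeft ∘ₗ A))
      (fun A B Φ => by rw [LinearMap.comp_add, map_add, neg_add])
      (fun c A Φ => by rw [LinearMap.comp_smul, map_smul, smul_neg])
      (fun A Φ Ψ => by rw [curryLeft_add, LinearMap.add_comp, map_add, neg_add])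
      (fun c A Φ => by rw [curryLeft_smul, LinearMap.smul_comp, map_smul, smul_neg])

theorem lieAct_succ {n : ℕ} (A : E →ₗ[ℝ] E) (Φ : E [⋀^Fin (n + 1)]→ₗ[ℝ] ℝ) :
    lieAct (n + 1) A Φ = -alternatizeUncurryFin (Φ.curryLeft ∘ₗ A) := rfl

theorem curryLeft_lieAct {n : ℕ} (A : E →ₗ[ℝ] E) (Φ : E [⋀^Fin (n + 1)]→ₗ[ℝ] ℝ) (x : E) :
    (lieAct (n + 1) A Φ).curryLeft x = lieAct n A (Φ.curryLeft x) - Φ.curryLeft (A x) := by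
  have hneg : ∀ f : E [⋀^Fin (n + 1)]→ₗ[ℝ] ℝ, (-f).curryLeft x = -f.curryLeft x := fun _ => rfl
  rw [lieAct_succ, hneg]
  cases n with
  | zero => simp [curryLeft_alternatizeUncurryFin_zero, lieAct]
  | succ n =>
    have h : curryLeftLinearMap.flip x ∘ₗ Φ.curryLeft ∘ₗ A = -((Φ.curryLeft x).curryLeft ∘ₗ A) := by
      ext1 y
      exact curryLeft_swap Φ (A y) x
    rw [curryLeft_alternatizeUncurryFin, h, lieAct_succ, alternatizeUncurryFin_neg,
      LinearMap.comp_apply]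
    abel

theorem lieAct_commutator (n : ℕ) (A B : E →ₗ[ℝ] E) (Φ : E [⋀^Fin n]→ₗ[ℝ] ℝ) :
    lieAct n (A ∘ₗ B - B ∘ₗ A) Φ = lieAct n A (lieAct n B Φ) - lieAct n B (lieAct n A Φ) := by
  induction n with
  | zero => simp [lieAct]
  | succ n ih =>
    refine curryLeft_ext fun x => ?_
    have hsub : ∀ f g : E [⋀^Fin (n + 1)]→ₗ[ℝ] ℝ,
      (f - g).curryLeft x = f.curryLeft x - g.curryLeft x := fun _ _ => rfl
    simp only [hsub, curryLeft_lieAct, ih]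
    simp only [LinearMap.sub_apply, LinearMap.comp_apply, map_sub]
    abel

/-- The Chevalley–Eilenberg differential with trivial coefficients, with values in alternating
maps, as a bilinear function of the bracket and the cochain. -/
noncomputable def ceDiff (n : ℕ) : (E →ₗ[ℝ] E →ₗ[ℝ] E) →ₗ[ℝ]
    (E [⋀^Fin n]→ₗ[ℝ] ℝ) →ₗ[ℝ] (E [⋀^Fin (n + 1)]→ₗ[ℝ] ℝ) :=
  LinearMap.mk₂ ℝ (fun br Φ => (2⁻¹ : ℝ) • alternatizeUncurryFinLM ((lieAct n).flip Φ ∘ₗ br))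
    (fun A B Φ => by rw [LinearMap.comp_add, map_add, smul_add])
    (fun c A Φ => by rw [LinearMap.comp_smul, map_smul, smul_comm])
    (fun A Φ Ψ => by rw [map_add, LinearMap.add_comp, map_add, smul_add])
    (fun c A Φ => by rw [map_smul, LinearMap.smul_comp, map_smul, smul_comm])

theorem ceDiff_apply (n : ℕ) (br : E →ₗ[ℝ] E →ₗ[ℝ] E) (Φ : E [⋀^Fin n]→ₗ[ℝ] ℝ) :
    ceDiff n br Φ = (2⁻¹ : ℝ) • alternatizeUncurryFinLM ((lieAct n).flip Φ ∘ₗ br) := rfl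

@[simp]
theorem ceDiff_zero (br : E →ₗ[ℝ] E →ₗ[ℝ] E) : ceDiff 0 br = 0 := by
  ext1 Φ
  have h : (lieAct 0).flip Φ ∘ₗ br = 0 := rfl
  rw [ceDiff_apply, h, map_zero, smul_zero, LinearMap.zero_apply]

theorem bracket_swap {br : E →ₗ[ℝ] E →ₗ[ℝ] E} (halt : ∀ x, br x x = 0) (x y : E) :
    br x y = -br y x := by
  have h := halt (x + y)
  simp only [map_add, LinearMap.add_apply, halt, zero_add, add_zero] at h
  exact eq_neg_of_add_eq_zero_right h

/-- Cartan's formula. -/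
theorem curryLeft_ceDiff {n : ℕ} {br : E →ₗ[ℝ] E →ₗ[ℝ] E} (halt : ∀ x, br x x = 0)
    (Φ : E [⋀^Fin (n + 1)]→ₗ[ℝ] ℝ) (x : E) :
    (ceDiff (n + 1) br Φ).curryLeft x =
      lieAct (n + 1) (br x) Φ - ceDiff n br (Φ.curryLeft x) := by
  have hsmul : ∀ f : E [⋀^Fin (n + 2)]→ₗ[ℝ] ℝ,
    ((2⁻¹ : ℝ) • f).curryLeft x = (2⁻¹ : ℝ) • f.curryLeft x := fun _ => rfl
  have h : curryLeftLinearMap.flip x ∘ₗ (lieAct (n + 1)).flip Φ ∘ₗ br =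
      (lieAct n).flip (Φ.curryLeft x) ∘ₗ br + Φ.curryLeft ∘ₗ br x := by
    ext1 y
    change (lieAct (n + 1) (br y) Φ).curryLeft x =
      lieAct n (br y) (Φ.curryLeft x) + Φ.curryLeft (br x y)
    rw [curryLeft_lieAct, bracket_swap halt x y, map_neg, sub_eq_add_neg]
  rw [ceDiff_apply, hsmul, alternatizeUncurryFinLM_apply, curryLeft_alternatizeUncurryFin, h,
    AlternatingMap.alternatizeUncurryFin_add, ceDiff_apply, alternatizeUncurryFinLM_apply,
    LinearMap.comp_apply, LinearMap.flip_apply, lieAct_succ]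
  module

theorem bracket_bracket {br : E →ₗ[ℝ] E →ₗ[ℝ] E} (halt : ∀ x, br x x = 0)
    (hjac : ∀ x y z, br x (br y z) + br y (br z x) + br z (br x y) = 0)
    (x y : E) : br (br x y) = br x ∘ₗ br y - br y ∘ₗ br x := by
  ext z
  have h := hjac x y z
  rw [bracket_swap halt z x, bracket_swap halt z (br x y), map_neg] at h
  simp only [LinearMap.sub_apply, LinearMap.comp_apply]
  rw [eq_comm, ← sub_eq_zero, ← h]
  abel

theorem lieAct_ceDiff {br : E →ₗ[ℝ] E →ₗ[ℝ] E} (halt : ∀ x, br x x = 0)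
    (hjac : ∀ x y z, br x (br y z) + br y (br z x) + br z (br x y) = 0)
    (n : ℕ) (z : E) (Φ : E [⋀^Fin n]→ₗ[ℝ] ℝ) :
    lieAct (n + 1) (br z) (ceDiff n br Φ) = ceDiff n br (lieAct n (br z) Φ) := by
  induction n with
  | zero => simp
  | succ n ih =>
    refine curryLeft_ext fun x => ?_
    simp only [curryLeft_lieAct, curryLeft_ceDiff halt, bracket_bracket halt hjac,
      lieAct_commutator]
    simp only [map_sub, ih]
    abel

theorem ceDiff_ceDiff {br : E →ₗ[ℝ] E →ₗ[ℝ] E} (halt : ∀ x, br x x = 0)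
    (hjac : ∀ x y z, br x (br y z) + br y (br z x) + br z (br x y) = 0)
    (n : ℕ) (Φ : E [⋀^Fin n]→ₗ[ℝ] ℝ) :
    ceDiff (n + 1) br (ceDiff n br Φ) = 0 := by
  induction n with
  | zero => simp
  | succ n ih =>
    refine curryLeft_ext fun x => ?_
    rw [curryLeft_ceDiff halt, curryLeft_ceDiff halt, map_sub, ih, lieAct_ceDiff halt hjac]
    simp

theorem ceDiff_succ_apply {n : ℕ} (br : E →ₗ[ℝ] E →ₗ[ℝ] E) (Φ : E [⋀^Fin (n + 1)]→ₗ[ℝ] ℝ) :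
    ceDiff (n + 1) br Φ = (-2⁻¹ : ℝ) •
      alternatizeUncurryFin (alternatizeUncurryFinLM ∘ₗ br.compr₂ Φ.curryLeft) := by
  have h : (lieAct (n + 1)).flip Φ ∘ₗ br =
    -(alternatizeUncurryFinLM ∘ₗ br.compr₂ Φ.curryLeft) := rfl
  rw [ceDiff_apply, h, alternatizeUncurryFinLM_apply, alternatizeUncurryFin_neg]
  module

instance finite_alternatingMap [FiniteDimensional ℝ E] (n : ℕ) :
    FiniteDimensional ℝ (E [⋀^Fin n]→ₗ[ℝ] ℝ) :=
  Module.Finite.of_injective (AlternatingMap.toMultilinearMapLM (S := ℝ))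
    AlternatingMap.coe_multilinearMap_injective

end Cochains

section Differential

variable {E : Type} [AddCommGroup E] [Module ℝ E]

theorem coe_ceDiff {br : E →ₗ[ℝ] E →ₗ[ℝ] E} (halt : ∀ x, br x x = 0) (n : ℕ)
    (Φ : E [⋀^Fin n]→ₗ[ℝ] ℝ) :
    ⇑(ceDiff n br Φ) = ceD br (0 : E →ₗ[ℝ] ℝ →ₗ[ℝ] ℝ) n Φ := by
  funext X
  change _ = ceDfun br _ Φ X
  cases n with
  | zero => simp [ceDfun]
  | succ n =>
    rw [ceDiff_succ_apply, AlternatingMap.smul_apply,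
      AlternatingMap.alternatizeUncurryFin_alternatizeUncurryFinLM_comp_apply]
    simp only [ceDfun, LinearMap.zero_apply, smul_zero, Finset.sum_const_zero, zero_add]
    conv_rhs => rw [Fin.sum_univ_castSucc]
    have hlast : ∀ t : Fin (n + 2), ¬ ((Fin.last (n + 1) : ℕ) < t) := by
      intro t; simp only [Fin.val_last]; omega
    simp only [hlast, if_false, Finset.sum_const_zero, add_zero]
    rw [Finset.smul_sum]
    refine Finset.sum_congr rfl fun i _ => ?_
    rw [Fin.sum_univ_succ, Finset.smul_sum, if_neg (by simp), zero_add, ← Finset.sum_filter]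
    refine Finset.sum_congr ?_ fun j hj => ?_
    · ext j
      simp only [Finset.mem_Ici, Finset.mem_filter, Finset.mem_univ, true_and, Fin.le_def,
        Fin.val_castSucc, Fin.val_succ, Nat.lt_succ_iff]
    · have hij : (i : ℕ) ≤ j := by simpa using hj
      have harg : (fun k : Fin (n + 1) =>
          if (k : ℕ) = 0 then br (X i.castSucc) (X j.succ)
          else if (k : ℕ) - 1 < (i.castSucc : ℕ) then X ⟨(k : ℕ) - 1, by omega⟩
          else if (k : ℕ) < (j.succ : ℕ) then X ⟨(k : ℕ), by omega⟩
          else X ⟨(k : ℕ) + 1, by omega⟩) =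
          Matrix.vecCons (br (X i.castSucc) (X j.succ))
            (j.removeNth (i.castSucc.removeNth X)) := by
        funext k
        refine Fin.cases (by simp) (fun k => ?_) k
        simp only [Fin.val_succ, Matrix.cons_val_succ, Fin.removeNth_apply, Fin.val_castSucc,
          Nat.add_one_sub_one, Nat.add_eq_zero_iff, one_ne_zero, and_false, if_false,
          Nat.add_lt_add_iff_right]
        simp only [← apply_ite X]
        congr 1
        ext
        simp only [Fin.succAbove, Fin.lt_def, Fin.val_castSucc]
        split_ifs <;> simp at * <;> omega
      rw [harg]
      rw [LinearMap.compr₂_apply, LinearMap.compr₂_apply, bracket_swap halt (X j.succ),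
        LinearMap.map_neg, AlternatingMap.neg_apply, AlternatingMap.curryLeft_apply_apply,
        Fin.val_castSucc, Fin.val_succ, ← add_assoc, pow_succ]
      simp only [zsmul_eq_mul, smul_eq_mul]
      push_cast
      ring

theorem ceDiff_conj (e : E ≃ₗ[ℝ] E) {br br' : E →ₗ[ℝ] E →ₗ[ℝ] E} (halt : ∀ x, br x x = 0)
    (h : ∀ x y, e (br' x y) = br (e x) (e y)) (n : ℕ) :
    ceDiff n br' = (AlternatingMap.domLCongr ℝ ℝ (Fin (n + 1)) ℝ e.symm).toLinearMap ∘ₗ ceDiff n br ∘ₗ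
      (AlternatingMap.domLCongr ℝ ℝ (Fin n) ℝ e).toLinearMap := by
  have halt' : ∀ x, br' x x = 0 := fun x => e.injective (by rw [h, halt, map_zero])
  ext Φ X
  simp only [LinearMap.comp_apply, LinearEquiv.coe_coe, AlternatingMap.domLCongr_apply, AlternatingMap.compLinearMap_apply]
  rw [coe_ceDiff halt, coe_ceDiff halt']
  change ceDfun _ _ _ _ = ceDfun _ _ _ _
  simp only [ceDfun, LinearMap.zero_apply, smul_zero, Finset.sum_const_zero, zero_add]
  refine Finset.sum_congr rfl fun s _ => Finset.sum_congr rfl fun t _ => ?_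
  split_ifs
  · rw [AlternatingMap.compLinearMap_apply]
    congr 2
    funext i
    split_ifs <;> simp [← h]
  · rfl

theorem ceZ_eq_ker {br : E →ₗ[ℝ] E →ₗ[ℝ] E} (halt : ∀ x, br x x = 0) (n : ℕ) :
    ceZ br (0 : E →ₗ[ℝ] ℝ →ₗ[ℝ] ℝ) n = LinearMap.ker (ceDiff n br) := by
  ext Φ
  rw [ceZ, LinearMap.mem_ker, LinearMap.mem_ker, ← coe_ceDiff halt]
  exact ⟨fun h => DFunLike.coe_injective h, fun h => by rw [h]; rfl⟩

theorem ceB_succ_eq_range {br : E →ₗ[ℝ] E →ₗ[ℝ] E} (halt : ∀ x, br x x = 0) (n : ℕ) :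
    ceB br (0 : E →ₗ[ℝ] ℝ →ₗ[ℝ] ℝ) (n + 1) = LinearMap.range (ceDiff n br) := by
  ext Φ
  simp only [ceB, Submodule.mem_comap, LinearMap.mem_range, ← coe_ceDiff halt]
  exact ⟨fun ⟨Ψ, h⟩ => ⟨Ψ, DFunLike.coe_injective h⟩, fun ⟨Ψ, h⟩ => ⟨Ψ, by rw [h]; rfl⟩⟩

variable [FiniteDimensional ℝ E]

theorem Hdim_add_finrank_ceB (μ : LieBracketOn E) (k : ℕ) :
    Hdim μ.br (0 : E →ₗ[ℝ] ℝ →ₗ[ℝ] ℝ) k +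
      Module.finrank ℝ (ceB μ.br (0 : E →ₗ[ℝ] ℝ →ₗ[ℝ] ℝ) k) +
      Module.finrank ℝ (LinearMap.range (ceDiff k μ.br)) =
      Module.finrank ℝ (E [⋀^Fin k]→ₗ[ℝ] ℝ) := by
  have hle : ceB μ.br (0 : E →ₗ[ℝ] ℝ →ₗ[ℝ] ℝ) k ≤ ceZ μ.br (0 : E →ₗ[ℝ] ℝ →ₗ[ℝ] ℝ) k := by
    cases k with
    | zero => exact bot_le
    | succ n =>
      rw [ceB_succ_eq_range μ.alt, ceZ_eq_ker μ.alt]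
      rintro _ ⟨Ψ, rfl⟩
      exact ceDiff_ceDiff μ.alt μ.jacobi n Ψ
  have hquot := Submodule.finrank_quotient_add_finrank (R := ℝ)
    (M := ceZ μ.br (0 : E →ₗ[ℝ] ℝ →ₗ[ℝ] ℝ) k)
    (Submodule.comap (ceZ μ.br (0 : E →ₗ[ℝ] ℝ →ₗ[ℝ] ℝ) k).subtype
      (ceB μ.br (0 : E →ₗ[ℝ] ℝ →ₗ[ℝ] ℝ) k))
  rw [(Submodule.comapSubtypeEquivOfLe hle).finrank_eq] at hquot
  have hrank := LinearMap.finrank_range_add_finrank_ker (ceDiff k μ.br)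
  rw [← ceZ_eq_ker μ.alt, ← hquot] at hrank
  rw [← hrank, add_comm]
  rfl

/-- If the ranks of the differentials decrease, the cohomology grows. -/
theorem Hdim_le_of_finrank_range_le (μ μ' : LieBracketOn E)
    (h : ∀ n, Module.finrank ℝ (LinearMap.range (ceDiff n μ'.br)) ≤
      Module.finrank ℝ (LinearMap.range (ceDiff n μ.br))) (k : ℕ) :
    Hdim μ.br (0 : E →ₗ[ℝ] ℝ →ₗ[ℝ] ℝ) k ≤ Hdim μ'.br (0 : E →ₗ[ℝ] ℝ →ₗ[ℝ] ℝ) k := by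
  have h₁ := Hdim_add_finrank_ceB μ k
  have h₂ := Hdim_add_finrank_ceB μ' k
  have hk := h k
  have hB : Module.finrank ℝ (ceB μ'.br (0 : E →ₗ[ℝ] ℝ →ₗ[ℝ] ℝ) k) ≤
      Module.finrank ℝ (ceB μ.br (0 : E →ₗ[ℝ] ℝ →ₗ[ℝ] ℝ) k) := by
    cases k with
    | zero => exact le_rfl
    | succ n =>
      rw [ceB_succ_eq_range μ.alt, ceB_succ_eq_range μ'.alt]
      exact h n
  omega

theorem finrank_range_ceDiff_conj_le (e : E ≃ₗ[ℝ] E) {br br' : E →ₗ[ℝ] E →ₗ[ℝ] E}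
    (halt : ∀ x, br x x = 0) (h : ∀ x y, e (br' x y) = br (e x) (e y)) (n : ℕ) :
    Module.finrank ℝ (LinearMap.range (ceDiff n br')) ≤
      Module.finrank ℝ (LinearMap.range (ceDiff n br)) := by
  rw [ceDiff_conj e halt h, LinearMap.range_comp]
  exact (Submodule.finrank_map_le _ _).trans
    (Submodule.finrank_mono (LinearMap.range_comp_le_range _ _))

end Differential

section Semicontinuity

variable {F F' : Type*} [AddCommGroup F] [Module ℝ F] [AddCommGroup F'] [Module ℝ F']
  [FiniteDimensional ℝ F]

/-- A linear family of linear maps depends on its parameter in a lower semicontinuous way,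
as far as the rank is concerned. -/
theorem eventually_finrank_range_le {B : Type*} [NormedAddCommGroup B] [NormedSpace ℝ B]
    [FiniteDimensional ℝ B] [FiniteDimensional ℝ F'] (T : B →ₗ[ℝ] F →ₗ[ℝ] F') (b₀ : B) :
    ∀ᶠ b in 𝓝 b₀, Module.finrank ℝ (LinearMap.range (T b₀)) ≤
      Module.finrank ℝ (LinearMap.range (T b)) := by
  let e : F' ≃ₗ[ℝ] (Fin (Module.finrank ℝ F') → ℝ) := (Module.finBasis ℝ F').equivFun
  let v := Module.finBasis ℝ (LinearMap.range (T b₀))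
  choose u hu using fun i => (v i).2
  have hcont : Continuous fun b => fun i => e (T b (u i)) :=
    continuous_pi fun i => (e.toLinearMap ∘ₗ T.flip (u i)).continuous_of_finiteDimensional
  have hlin : LinearIndependent ℝ fun i => e (T b₀ (u i)) := by
    have : LinearIndependent ℝ fun i => T b₀ (u i) := by
      simp only [hu]
      exact v.linearIndependent.map' _ (Submodule.ker_subtype _)
    exact this.map' e.toLinearMap e.ker
  filter_upwards [hcont.continuousAt.eventually hlin.eventually] with b hb
  have hb' : LinearIndependent ℝ fun i => T b (u i) := LinearIndependent.of_comp e.toLinearMap hb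
  have hmem : LinearIndependent ℝ
      fun i => (⟨T b (u i), u i, rfl⟩ : LinearMap.range (T b)) :=
    LinearIndependent.of_comp (LinearMap.range (T b)).subtype hb'
  simpa using hmem.fintype_card_le_finrank

end Semicontinuity

theorem eventually_finrank_range_ceDiff_le {V : Type*} [NormedAddCommGroup V] [NormedSpace ℝ V]
    [FiniteDimensional ℝ V] {ι : Type*} {l : Filter ι} (br : ι → V →ₗ[ℝ] V →ₗ[ℝ] V)
    (br' : V →ₗ[ℝ] V →ₗ[ℝ] V) (h : ∀ x y, Tendsto (fun t => br t x y) l (𝓝 (br' x y))) (n : ℕ) :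
    ∀ᶠ t in l, Module.finrank ℝ (LinearMap.range (ceDiff n br')) ≤
      Module.finrank ℝ (LinearMap.range (ceDiff n (br t))) := by
  let b := Module.finBasis ℝ V
  let ev : (V →ₗ[ℝ] V →ₗ[ℝ] V) →ₗ[ℝ]
      (Fin (Module.finrank ℝ V) → Fin (Module.finrank ℝ V) → V) :=
    { toFun := fun f i j => f (b i) (b j)
      map_add' := fun _ _ => rfl
      map_smul' := fun _ _ => rfl }
  have hker : LinearMap.ker ev = ⊥ := LinearMap.ker_eq_bot'.2 fun f hf =>
    b.ext fun i => b.ext fun j => congrFun (congrFun hf i) j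
  obtain ⟨G, hG⟩ := ev.exists_leftInverse_of_injective hker
  have hGev : ∀ f, G (ev f) = f := LinearMap.congr_fun hG
  have hlim : Tendsto (fun t => ev (br t)) l (𝓝 (ev br')) :=
    tendsto_pi_nhds.2 fun i => tendsto_pi_nhds.2 fun j => h (b i) (b j)
  filter_upwards [hlim.eventually (eventually_finrank_range_le (ceDiff n ∘ₗ G) (ev br'))] with t ht
  rwa [LinearMap.comp_apply, LinearMap.comp_apply, hGev, hGev] at ht

end CE

open CE in
/-- If `g = (V,μ)` contracts onto `g' = (V,μ')`, then
`dim H^k(g,ℝ) ≤ dim H^k(g',ℝ)` for every `k ≥ 0` (trivial coefficients: `ρ = 0`). -/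
theorem contraction_trivial_cohomology_dim_le [FiniteDimensional ℝ V]
    (μ μ' : LieBracketOn V) (h : Contracts μ μ') (k : ℕ) :
    Hdim μ.br (0 : V →ₗ[ℝ] ℝ →ₗ[ℝ] ℝ) k ≤ Hdim μ'.br (0 : V →ₗ[ℝ] ℝ →ₗ[ℝ] ℝ) k := by
  obtain ⟨Φ, hΦ⟩ := h
  refine Hdim_le_of_finrank_range_le μ μ' (fun n => ?_) k
  let br : ℝ → V →ₗ[ℝ] V →ₗ[ℝ] V := fun t =>
    (μ.br.compl₁₂ (Φ t).toLinearMap (Φ t).toLinearMap).compr₂ (Φ t).symm.toLinearMap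
  obtain ⟨t, ht⟩ := (eventually_finrank_range_ceDiff_le br μ'.br hΦ n).exists
  exact ht.trans (finrank_range_ceDiff_conj_le (Φ t) μ.alt (fun x y => by simp [br]) n)
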